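/- Let F be a characteristic-zero differential field whose field of constants C is algebraically closed, let x_1,…,x_l be algebraically independent antiderivatives of F (x_i′ ∈ F) in a no-new-constants differential field extension E of F, and let y_1,…,y_m ∈ E be J-I-E antiderivatives of F(x_1,…,x_l), with E = F(y_1,…,y_m,x_1,…,x_l). Then every intermediate field K with F ⊆ K ⊆ E that is closed under the derivation of E is of the form K = F(S ∪ T), where S is a finite subset of the C-linear span of {y_1,…,y_m,x_1,…,x_l} and T is a finite subset of the C-linear span of {x_1,…,x_l}. -/

import Mathlib

/-- A derivation on a field: an additive map satisfying the Leibniz rule. -/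
structure IsDerivation {E : Type*} [Field E] (D : E → E) : Prop where
  map_add : ∀ a b : E, D (a + b) = D a + D b
  leibniz : ∀ a b : E, D (a * b) = D a * b + a * D b

section helpers
open Polynomial

/-- Closed under the derivation. -/
def JStable {E : Type*} [Field E] (D : Derivation ℤ E E) (K : Subfield E) : Prop :=
  ∀ a ∈ K, D a ∈ K

section part1
set_option linter.unusedSectionVars false
variable {E : Type*} [Field E] {D : Derivation ℤ E E} {K : Subfield E}

lemma jD_div (D : Derivation ℤ E E) (a b : E) (hb : b ≠ 0) :
    D (a / b) = (D a * b - a * D b) / b ^ 2 := by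
  have h : D (a / b * b) = D a := by rw [div_mul_cancel₀ _ hb]
  rw [D.leibniz] at h
  simp only [smul_eq_mul] at h
  rw [← h]
  field_simp
  ring

lemma jstable_sup (hK : JStable D K) {S : Set E} (hS : ∀ s ∈ S, D s ∈ K ⊔ Subfield.closure S) :
    JStable D (K ⊔ Subfield.closure S) := by
  have e : K ⊔ Subfield.closure S = Subfield.closure (↑K ∪ S) := by
    rw [Subfield.closure_union, Subfield.closure_eq]
  intro a ha
  rw [e] at ha
  induction ha using Subfield.closure_induction with
  | mem x hx =>
    rcases hx with hx | hx
    · exact (le_sup_left : K ≤ _) (hK x hx)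
    · exact hS x hx
  | one => simp
  | add x y hx hy h1 h2 => rw [map_add]; exact add_mem h1 h2
  | neg x hx h => rw [map_neg]; exact neg_mem h
  | inv x hx h =>
    rw [← e] at hx
    by_cases h0 : x = 0
    · simp [h0]
    · rw [← one_div, jD_div _ _ _ h0]
      refine div_mem (sub_mem (mul_mem ?_ hx) (mul_mem (one_mem _) h)) (pow_mem hx _)
      simp
  | mul x y hx hy h1 h2 =>
    rw [← e] at hx hy
    rw [D.leibniz]
    exact add_mem (mul_mem hx h2) (mul_mem hy h1)

/-- The restricted derivation on a stable subfield. -/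
def jrestrict (hK : JStable D K) : Derivation ℤ K K :=
  Derivation.mk' (AddMonoidHom.toIntLinearMap
    { toFun := fun a => (⟨D a, hK a a.2⟩ : K)
      map_zero' := by ext; simp
      map_add' := fun a b => by ext; simp })
    (fun a b => by ext; simp [D.leibniz])

lemma jrestrict_coe (hK : JStable D K) (a : K) : (jrestrict hK a : E) = D a := rfl

lemma exists_jdl (hK : JStable D K) (t : E) (ht : D t ∈ K) :
    ∃ δ : Derivation ℤ K[X] K[X], (∀ p, aeval t (δ p) = D (aeval t p)) ∧
      (∀ p n, ((δ p).coeff n : E) = D (p.coeff n) + (n + 1) * p.coeff (n + 1) * D t) ∧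
      (∀ p, derivative (δ p) = δ (derivative p)) := by
  let _ : Differential K := ⟨jrestrict hK⟩
  have hc : ∀ a : K, ((Differential.deriv a : K) : E) = D a := fun a => rfl
  have hco : ∀ p : K[X], ∀ n, (Differential.mapCoeffs p).coeff n = Differential.deriv (p.coeff n) :=
    fun p n => rfl
  let τ : K := ⟨D t, ht⟩
  refine ⟨Differential.mapCoeffs + (C τ : K[X]) • (derivative' (R := K)).restrictScalars ℤ,
    ?_, ?_, ?_⟩
  · intro p
    induction p using Polynomial.induction_on' with
    | add p q hp hq => simp only [map_add, hp, hq]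
    | monomial n a =>
      simp [Differential.mapCoeffs_monomial, aeval_monomial, D.leibniz, D.leibniz_pow, τ,
        derivative_monomial]
      have : (algebraMap K E) (Differential.deriv a) = D (a : E) := rfl
      rw [this]
      simp [Algebra.algebraMap_ofSubsemiring_apply]
      ring
  · intro p n
    have : (Differential.mapCoeffs p + C τ * derivative p).coeff n =
      Differential.deriv (p.coeff n) + τ * (p.coeff (n+1) * (n+1)) := by
      rw [coeff_add, coeff_C_mul, coeff_derivative, hco]
    change (((Differential.mapCoeffs p + C τ * derivative p).coeff n : K) : E) = _
    rw [this]
    push_cast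
    rw [hc]
    simp only [τ]
    ring
  · intro p
    change derivative (Differential.mapCoeffs p + C τ * derivative p) =
      Differential.mapCoeffs (derivative p) + C τ * derivative (derivative p)
    have : derivative (Differential.mapCoeffs p) = Differential.mapCoeffs (derivative p) := by
      ext n
      rw [hco, coeff_derivative, coeff_derivative, hco, Derivation.leibniz]
      have : Differential.deriv ((n:K) + 1) = 0 := by simp
      rw [this]
      simp [mul_comm]
    simp [this]

lemma jmem_simple {t z : E} (hz : z ∈ K ⊔ Subfield.closure {t}) :
    ∃ p q : K[X], aeval t q ≠ 0 ∧ IsCoprime p q ∧ z = aeval t p / aeval t q := by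
  have e : K ⊔ Subfield.closure {t} = (IntermediateField.adjoin K {t}).toSubfield := by
    rw [IntermediateField.adjoin_toSubfield, Subfield.closure_union]
    congr 1
    have : Set.range (algebraMap K E) = K := by ext; simp [Algebra.algebraMap_ofSubsemiring_apply]
    rw [this, Subfield.closure_eq]
  rw [e] at hz
  obtain ⟨p, q, h⟩ := (IntermediateField.mem_adjoin_simple_iff K z).1 hz
  by_cases hq : aeval t q = 0
  · exact ⟨0, 1, by simp, isCoprime_zero_left.2 isUnit_one, by simp [h, hq]⟩
  · have hq0 : q ≠ 0 := by rintro rfl; simp at hq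
    obtain ⟨p1, q1, g, hco, h1, h2⟩ := UniqueFactorizationMonoid.exists_reduced_factors' p q hq0
    subst h1 h2
    rw [map_mul] at hq
    refine ⟨p1, q1, right_ne_zero_of_mul hq, hco.isCoprime, ?_⟩
    rw [h, map_mul, map_mul, mul_div_mul_left _ _ (left_ne_zero_of_mul hq)]

lemma jaeval_mem (t : E) {L : Subfield E} (hKL : K ≤ L) (ht : t ∈ L) (p : K[X]) :
    aeval t p ∈ L := by
  induction p using Polynomial.induction_on' with
  | add p q hp hq => rw [map_add]; exact add_mem hp hq
  | monomial n a =>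
    rw [aeval_monomial]
    exact mul_mem (hKL a.2) (pow_mem ht n)

lemma jinj {t : E} (ht : Transcendental K t) {p q : K[X]} (h : aeval t p = aeval t q) : p = q :=
  (transcendental_iff_injective.1 ht) h

lemma jnatDegree_zero_mem {t : E} {p : K[X]} (hp : p.natDegree = 0) : aeval t p ∈ K := by
  rw [eq_C_of_natDegree_eq_zero hp, aeval_C]
  exact (p.coeff 0).2

lemma jmem_natDegree_zero {t : E} (ht : Transcendental K t) {p : K[X]} (hp : aeval t p ∈ K) :
    p.natDegree = 0 := by
  have : p = C ⟨_, hp⟩ := jinj ht (by rw [aeval_C]; rfl)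
  rw [this, natDegree_C]

variable [CharZero E]

/-- Elements algebraic over `K` with derivative in `K` lie in `K`. -/
lemma jL0 (hK : JStable D K) (hN : ∀ a, D a = 0 → a ∈ K) {r : E} (hr : D r ∈ K)
    (ha : IsAlgebraic K r) : r ∈ K := by
  obtain ⟨δ, h1, h2, -⟩ := exists_jdl hK r hr
  set p := minpoly K r with hp
  have hm : p.Monic := minpoly.monic ha.isIntegral
  have hn : 0 < p.natDegree := minpoly.natDegree_pos ha.isIntegral
  have h0 : δ p = 0 := by
    by_contra hne
    have hz : aeval r (δ p) = 0 := by rw [h1, hp, minpoly.aeval, map_zero]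
    have := minpoly.degree_le_of_ne_zero K r hne hz
    rw [← hp] at this
    have hlt : (δ p).degree < p.degree := by
      rw [Polynomial.degree_eq_natDegree hm.ne_zero, Polynomial.degree_lt_iff_coeff_zero]
      intro k hk
      apply Subtype.ext
      rw [h2, Polynomial.coeff_eq_zero_of_natDegree_lt (n := k + 1) (by omega)]
      rcases hk.lt_or_eq with hk | hk
      · rw [Polynomial.coeff_eq_zero_of_natDegree_lt hk]; simp
      · rw [← hk, hm.coeff_natDegree]; simp
    exact absurd hlt (not_lt.2 this)
  obtain ⟨n, hn'⟩ : ∃ n, p.natDegree = n + 1 := ⟨p.natDegree - 1, by omega⟩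
  have h3 := h2 p n
  rw [h0, ← hn', hm.coeff_natDegree] at h3
  have h4 : D (p.coeff n + (n + 1) * r) = 0 := by
    rw [map_add, D.leibniz]
    simp at h3 ⊢
    linear_combination -h3
  have h5 := hN _ h4
  have h6 : ((n : E) + 1) ≠ 0 := by exact_mod_cast Nat.succ_ne_zero n
  have : r = (p.coeff n + (n + 1) * r - p.coeff n) / ((n : E) + 1) := by field_simp; ring
  rw [this]
  exact div_mem (sub_mem h5 (p.coeff n).2) (add_mem (natCast_mem _ _) (one_mem _))

lemma jU (hK : JStable D K) (hN : ∀ a, D a = 0 → a ∈ K) {t : E} (ht : Transcendental K t)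
    {p q : K[X]} (hq : aeval t q = D (aeval t p)) (htK : D t ∈ K) (hpq : p ∣ q) :
    p.natDegree = 0 := by
  obtain ⟨δ, h1, h2, -⟩ := exists_jdl hK t htK
  by_cases hp0 : p = 0
  · simp [hp0]
  have hq' : q = δ p := jinj ht (by rw [hq, h1])
  subst hq'
  set u : K := p.leadingCoeff with hu
  have hu0 : u ≠ 0 := leadingCoeff_ne_zero.2 hp0
  set p1 := C u⁻¹ * p with hp1
  have hm : p1.Monic := by
    rw [hp1, mul_comm]; exact monic_mul_leadingCoeff_inv hp0
  have hdv : p1 ∣ δ p1 := by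
    have hpp : p1 ∣ p := ⟨C u, by rw [hp1, mul_right_comm, ← C_mul, inv_mul_cancel₀ hu0]; simp⟩
    conv_rhs => rw [hp1]
    rw [δ.leibniz]
    exact dvd_add ((hpp.trans hpq).mul_left _) (hpp.mul_right _)
  have h0 : δ p1 = 0 := by
    by_contra hne
    have hlt : (δ p1).degree < p1.degree := by
      rw [Polynomial.degree_eq_natDegree hm.ne_zero, Polynomial.degree_lt_iff_coeff_zero]
      intro k hk
      apply Subtype.ext
      rw [h2, Polynomial.coeff_eq_zero_of_natDegree_lt (n := k + 1) (by omega)]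
      rcases hk.lt_or_eq with hk | hk
      · rw [Polynomial.coeff_eq_zero_of_natDegree_lt hk]; simp
      · rw [← hk, hm.coeff_natDegree]; simp
    exact hne (Polynomial.eq_zero_of_dvd_of_degree_lt hdv hlt)
  have h3 : D (aeval t p1) = 0 := by rw [← h1, h0, map_zero]
  have h4 := jmem_natDegree_zero ht (hN _ h3)
  rw [hp1, natDegree_C_mul (inv_ne_zero hu0)] at h4
  exact h4

lemma jL1 (hK : JStable D K) (hN : ∀ a, D a = 0 → a ∈ K) {t : E} (ht : Transcendental K t)
    (htK : D t ∈ K) {r : E} (hr : r ∈ K ⊔ Subfield.closure {t}) (hrK : D r ∈ K) :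
    ∃ c, D c = 0 ∧ r - c * t ∈ K := by
  obtain ⟨δ, h1, h2, -⟩ := exists_jdl hK t htK
  obtain ⟨p, q, hq0, hco, rfl⟩ := jmem_simple hr
  have hq : q.natDegree = 0 := by
    refine jU hK hN ht (h1 q) htK ?_
    have e : δ p * q - p * δ q = C ⟨_, hrK⟩ * q ^ 2 := by
      apply jinj ht
      simp only [map_sub, map_mul, h1, map_pow, aeval_C]
      change _ = D _ * _
      rw [jD_div _ _ _ hq0]
      field_simp
    have : q ∣ p * δ q := ⟨δ p - C ⟨_, hrK⟩ * q, by linear_combination -e⟩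
    exact hco.symm.dvd_of_dvd_mul_left this
  obtain ⟨s, hs⟩ : ∃ s : K[X], aeval t p / aeval t q = aeval t s := by
    refine ⟨C (q.coeff 0)⁻¹ * p, ?_⟩
    conv_lhs => rw [eq_C_of_natDegree_eq_zero hq]
    rw [map_mul, aeval_C, aeval_C, map_inv₀]
    ring
  rw [hs] at hrK ⊢
  have hds : δ s = C ⟨_, hrK⟩ := jinj ht (by rw [h1, aeval_C]; rfl)
  have hdeg : s.natDegree ≤ 1 := by
    by_contra hlt
    obtain ⟨n, hn⟩ : ∃ n, s.natDegree = n + 2 := ⟨s.natDegree - 2, by omega⟩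
    have h3 := h2 s (n + 2)
    have h4 := h2 s (n + 1)
    rw [hds, coeff_C_of_ne_zero (by omega)] at h3 h4
    rw [coeff_eq_zero_of_natDegree_lt (n := n + 2 + 1) (by omega)] at h3
    have hl : (s.coeff (n + 2) : E) ≠ 0 := by
      have : s ≠ 0 := by rintro rfl; simp at hn
      have := leadingCoeff_ne_zero.2 this
      rw [leadingCoeff, hn] at this
      exact_mod_cast this
    have h3' : D (s.coeff (n + 2)) = 0 := by simpa using h3.symm
    have h5 : D (s.coeff (n + 1) + ((n + 1 : ℕ) + 1) * s.coeff (n + 2) * t) = 0 := by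
      rw [map_add, D.leibniz, D.leibniz, h3']
      simp at h4 ⊢
      linear_combination -h4
    have h6 := hN _ h5
    have h7 : (((n + 1 : ℕ) + 1 : E)) ≠ 0 := by exact_mod_cast Nat.succ_ne_zero (n + 1)
    have : t ∈ K := by
      have e : t = (s.coeff (n + 1) + ((n + 1 : ℕ) + 1) * s.coeff (n + 2) * t - s.coeff (n + 1)) /
        (((n + 1 : ℕ) + 1) * s.coeff (n + 2)) := by field_simp; ring
      rw [e]
      exact div_mem (sub_mem h6 (s.coeff _).2)
        (mul_mem (add_mem (natCast_mem _ _) (one_mem _)) (s.coeff _).2)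
    exact ht (isAlgebraic_algebraMap (⟨t, this⟩ : K))
  refine ⟨s.coeff 1, ?_, ?_⟩
  · have h3 := h2 s 1
    rw [hds, coeff_C_of_ne_zero (by omega), coeff_eq_zero_of_natDegree_lt (n := 1 + 1) (by omega)] at h3
    simpa using h3.symm
  · have : aeval t s = s.coeff 0 + s.coeff 1 * t := by
      conv_lhs => rw [eq_X_add_C_of_natDegree_le_one hdeg]
      simp [Algebra.algebraMap_ofSubsemiring_apply]
      ring
    rw [this, add_sub_cancel_right]
    exact (s.coeff 0).2

lemma jL (hK : JStable D K) (hN : ∀ a, D a = 0 → a ∈ K) {t : E}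
    (htK : D t ∈ K) {r : E} (hr : r ∈ K ⊔ Subfield.closure {t}) (hrK : D r ∈ K) :
    ∃ c, D c = 0 ∧ r - c * t ∈ K := by
  by_cases ht : IsAlgebraic K t
  · have := jL0 hK hN htK ht
    refine ⟨0, map_zero D, ?_⟩
    have : K ⊔ Subfield.closure {t} = K := by
      rw [sup_eq_left, Subfield.closure_le]; simpa using this
    rw [this] at hr
    simpa using hr
  · exact jL1 hK hN ht htK hr hrK

lemma jM {L : Subfield E} (hLK : L ≤ K) {t : E} (ht : Transcendental K t) {k : E} (hk : k ∈ K)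
    (hkL : k ∈ L ⊔ Subfield.closure {t}) : k ∈ L := by
  obtain ⟨p, q, hq0, hco, rfl⟩ := jmem_simple hkL
  let i : L →+* K := Subfield.inclusion hLK
  have hi : ∀ s : L[X], aeval t (s.map i) = aeval t s := fun s => by
    rw [aeval_def, aeval_def, eval₂_map]; rfl
  have e : C ⟨_, hk⟩ * q.map i = p.map i := by
    apply jinj ht
    rw [map_mul, hi, hi, aeval_C]
    change aeval t p / aeval t q * _ = _
    field_simp
  have hq : q ≠ 0 := by rintro rfl; simp at hq0
  obtain ⟨n, hn⟩ : ∃ n, q.coeff n ≠ 0 := by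
    by_contra! h
    exact hq (by ext n; simp [h])
  have e2 := congrArg (fun s : K[X] => ((s.coeff n : K) : E)) e
  simp only [coeff_C_mul, coeff_map] at e2
  change (aeval t p / aeval t q) * (q.coeff n : E) = (p.coeff n : E) at e2
  have hn' : (q.coeff n : E) ≠ 0 := by exact_mod_cast hn
  rw [eq_div_of_mul_eq hn' e2]
  exact div_mem (p.coeff n).2 (q.coeff n).2


lemma jsup_insert {ι : Type*} [DecidableEq ι] (K : Subfield E) (u : ι → E) (a : ι) (s : Finset ι) :
    K ⊔ Subfield.closure (u '' ↑(insert a s)) =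
      (K ⊔ Subfield.closure {u a}) ⊔ Subfield.closure (u '' ↑s) := by
  rw [Finset.coe_insert, Set.image_insert_eq, Set.insert_eq, Subfield.closure_union, sup_assoc]

lemma jKO {C : Subfield E} (hC : ∀ c, c ∈ C ↔ D c = 0) {ι : Type*} [DecidableEq ι] (u : ι → E)
    (s : Finset ι) :
    ∀ (K : Subfield E) (_ : JStable D K) (_ : ∀ a, D a = 0 → a ∈ K) (_ : ∀ i, D (u i) ∈ K)
      (r : E) (_ : r ∈ K ⊔ Subfield.closure (u '' ↑s)) (_ : D r ∈ K),
      ∃ v ∈ Submodule.span C (u '' ↑s), r - v ∈ K := by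
  induction s using Finset.induction_on with
  | empty =>
    intro K hK hN hu r hr hrK
    refine ⟨0, zero_mem _, ?_⟩
    simpa using hr
  | insert a s ha ih =>
    intro K hK hN hu r hr hrK
    rw [jsup_insert] at hr
    have hle : K ≤ K ⊔ Subfield.closure {u a} := le_sup_left
    obtain ⟨v, hv, hrv⟩ := ih (K ⊔ Subfield.closure {u a})
      (jstable_sup hK (by rintro _ rfl; exact hle (hu a)))
      (fun b hb => hle (hN b hb)) (fun i => hle (hu i)) r hr (hle hrK)
    have hDv : D v ∈ K := by
      clear hrv
      induction hv using Submodule.span_induction with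
      | mem x hx => obtain ⟨i, -, rfl⟩ := hx; exact hu i
      | zero => simp
      | add x y _ _ h1 h2 => rw [map_add]; exact add_mem h1 h2
      | smul c x _ h =>
        have : D (c • x) = c • D x := by
          change D ((c : E) * x) = c * D x
          rw [D.leibniz, (hC c).1 c.2]; simp
        rw [this]
        exact mul_mem (hN _ ((hC c).1 c.2)) h
    obtain ⟨c, hc, h⟩ := jL hK hN (hu a) hrv (by rw [map_sub]; exact sub_mem hrK hDv)
    refine ⟨v + c * u a, add_mem (Submodule.span_mono (by gcongr; simp) hv) ?_, ?_⟩
    · exact Submodule.smul_mem _ (⟨c, (hC c).2 hc⟩ : C) (Submodule.subset_span ⟨a, by simp, rfl⟩)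
    · rwa [← sub_sub]

lemma jspan_le {C : Subfield E} (K : Subfield E) (hCK : C ≤ K) {S : Set E} (hS : S ⊆ K) {v : E}
    (hv : v ∈ Submodule.span C S) : v ∈ K := by
  induction hv using Submodule.span_induction with
  | mem x hx => exact hS hx
  | zero => exact zero_mem _
  | add x y _ _ h1 h2 => exact add_mem h1 h2
  | smul c x _ h => exact mul_mem (hCK c.2) h

lemma jD_span {C : Subfield E} (hC : ∀ c, c ∈ C ↔ D c = 0) (hCK : C ≤ K) {S : Set E}
    (hS : ∀ s ∈ S, D s ∈ K) {v : E} (hv : v ∈ Submodule.span C S) : D v ∈ K := by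
  induction hv using Submodule.span_induction with
  | mem x hx => exact hS x hx
  | zero => simp
  | add x y _ _ h1 h2 => rw [map_add]; exact add_mem h1 h2
  | smul c x _ h =>
    have : D (c • x) = c • D x := by
      change D ((c : E) * x) = c * D x
      rw [D.leibniz, (hC c).1 c.2]; simp
    rw [this]
    exact mul_mem (hCK c.2) h

lemma jS1 {C : Subfield E} (hC : ∀ c, c ∈ C ↔ D c = 0) {ι : Type*} [DecidableEq ι] (u : ι → E)
    (hK : JStable D K) (s : Finset ι) :
    ∀ (L : Subfield E) (_ : ∀ a, D a = 0 → a ∈ L) (_ : L ≤ K)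
      (_ : ∀ i, D (u i) ∈ L) (_ : K ≤ L ⊔ Subfield.closure (u '' ↑s)),
      K ≤ L ⊔ Subfield.closure (↑K ∩ (Submodule.span C (u '' ↑s) : Set E)) := by
  induction s using Finset.induction_on with
  | empty =>
    intro L hN hLK hu hKL
    simp at hKL
    exact hKL.trans le_sup_left
  | insert a s ha ih =>
    intro L hN hLK hu hKL
    have hCL : C ≤ L := fun c hc => hN c ((hC c).1 hc)
    have hK' : K ≤ K ⊔ Subfield.closure (u '' ↑s) := le_sup_left
    have hmono : Submodule.span C (u '' ↑s) ≤ Submodule.span C (u '' ↑(insert a s)) :=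
      Submodule.span_mono (by gcongr; simp)
    by_cases hta : IsAlgebraic ↥(K ⊔ Subfield.closure (u '' ↑s)) (u a)
    · have h1 := jL0 (jstable_sup hK (by rintro _ ⟨i, -, rfl⟩; exact hK' (hLK (hu i))))
        (fun b hb => hK' (hLK (hN b hb))) (hK' (hLK (hu a))) hta
      obtain ⟨v, hv, hw⟩ := jKO hC u s K hK (fun b hb => hLK (hN b hb)) (fun i => hLK (hu i)) _ h1
        (hLK (hu a))
      set w := u a - v with hwdef
      have hwS : w ∈ Submodule.span C (u '' ↑(insert a s)) :=
        sub_mem (Submodule.subset_span ⟨a, by simp, rfl⟩) (hmono hv)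
      have hDw : D w ∈ L := jD_span hC hCL (by rintro _ ⟨i, -, rfl⟩; exact hu i) hwS
      have hLL : L ≤ L ⊔ Subfield.closure {w} := le_sup_left
      have := ih (L ⊔ Subfield.closure {w})
        (fun b hb => hLL (hN b hb))
        (sup_le hLK (by rw [Subfield.closure_le]; simpa using hw)) (fun i => hLL (hu i)) (by
          refine hKL.trans (sup_le (hLL.trans le_sup_left) ?_)
          rw [Subfield.closure_le]
          have hs : ∀ i ∈ s, u i ∈ L ⊔ Subfield.closure {w} ⊔ Subfield.closure (u '' ↑s) :=
            fun i hi => (le_sup_right : Subfield.closure (u '' ↑s) ≤ _)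
              (Subfield.subset_closure ⟨i, hi, rfl⟩)
          rintro _ ⟨i, hi, rfl⟩
          rcases Finset.mem_insert.1 (by exact_mod_cast hi) with rfl | hi
          · have e : u i = w + v := by rw [hwdef]; ring
            change u i ∈ _
            rw [e]
            refine add_mem ?_ ?_
            · exact (le_sup_left : L ⊔ Subfield.closure {w} ≤ _)
                ((le_sup_right : Subfield.closure {w} ≤ _) (Subfield.subset_closure rfl))
            · refine jspan_le _ (hCL.trans (hLL.trans le_sup_left)) ?_ hv
              rintro _ ⟨j, hj, rfl⟩
              exact hs j hj
          · exact hs i hi)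
      refine this.trans (sup_le (sup_le le_sup_left ?_) ?_)
      · rw [Subfield.closure_le]
        rintro _ rfl
        exact (le_sup_right : Subfield.closure _ ≤ _) (Subfield.subset_closure ⟨hw, hwS⟩)
      · refine le_sup_of_le_right (Subfield.closure_mono ?_)
        exact Set.inter_subset_inter_right _ hmono
    · have : K ≤ L ⊔ Subfield.closure (u '' ↑s) := by
        intro k hk
        have h1 := hKL hk
        rw [jsup_insert, sup_right_comm] at h1
        exact jM (sup_le_sup_right hLK _) hta (hK' hk) h1
      refine (ih L hN hLK hu this).trans (sup_le_sup_left (Subfield.closure_mono ?_) _)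
      exact Set.inter_subset_inter_right _ hmono


/-- Formal derivative with respect to `t` on `K(t)`, as a relation. -/
def JRel (K : Subfield E) (t z w : E) : Prop :=
  ∃ p q : K[X], aeval t q ≠ 0 ∧ z = aeval t p / aeval t q ∧
    w = (aeval t (derivative p) * aeval t q - aeval t p * aeval t (derivative q)) /
      (aeval t q) ^ 2

lemma jrel_unique {t z w w' : E} (ht : Transcendental K t) (h : JRel K t z w)
    (h' : JRel K t z w') : w = w' := by
  obtain ⟨p, q, hq, hz, rfl⟩ := h
  obtain ⟨p', q', hq', hz', rfl⟩ := h'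
  have e : p * q' = p' * q := by
    apply jinj ht
    rw [hz] at hz'
    rw [map_mul, map_mul]
    field_simp at hz'
    linear_combination hz'
  have e2 := congrArg (fun s => aeval t (derivative s)) e
  have e1 := congrArg (aeval t) e
  simp only [derivative_mul, map_add, map_mul] at e2 e1
  have hp : aeval t p = z * aeval t q := by rw [hz]; field_simp
  have hp' : aeval t p' = z * aeval t q' := by rw [hz']; field_simp
  rw [hp, hp'] at e2 ⊢
  field_simp
  linear_combination e2

lemma jrel_add {t z w z' w' : E} (h : JRel K t z w)
    (h' : JRel K t z' w') : JRel K t (z + z') (w + w') := by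
  obtain ⟨p, q, hq, rfl, rfl⟩ := h
  obtain ⟨p', q', hq', rfl, rfl⟩ := h'
  refine ⟨p * q' + p' * q, q * q', by rw [map_mul]; exact mul_ne_zero hq hq', ?_, ?_⟩
  · simp only [map_mul, map_add]
    field_simp
  · simp only [map_mul, map_add, derivative_mul]
    field_simp
    ring

lemma jrel_const_mul {t z w : E} (c : E) (hc : c ∈ K) (h : JRel K t z w) :
    JRel K t (c * z) (c * w) := by
  obtain ⟨p, q, hq, rfl, rfl⟩ := h
  refine ⟨C ⟨c, hc⟩ * p, q, hq, ?_, ?_⟩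
  · rw [map_mul, aeval_C]
    change _ = c * _ / _
    ring
  · simp only [derivative_mul, derivative_C, zero_mul, zero_add, map_mul, aeval_C]
    change _ = (c * _ * _ - c * _ * _) / _
    ring

lemma jrel_sum {κ : Type*} {t : E} (s : Finset κ) (z w : κ → E) (h : ∀ i ∈ s, JRel K t (z i) (w i)) :
    JRel K t (∑ i ∈ s, z i) (∑ i ∈ s, w i) := by
  classical
  induction s using Finset.induction_on with
  | empty => exact ⟨0, 1, by simp, by simp, by simp⟩
  | insert a s ha ih =>
    rw [Finset.sum_insert ha, Finset.sum_insert ha]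
    exact jrel_add (h a (by simp)) (ih fun i hi => h i (by simp [hi]))

lemma jrel_D (hK : JStable D K) {t z w : E} (htK : D t ∈ K) (h : JRel K t z w) :
    JRel K t (D z) (D w) := by
  obtain ⟨δ, h1, -, h3⟩ := exists_jdl hK t htK
  obtain ⟨p, q, hq, rfl, rfl⟩ := h
  refine ⟨δ p * q - p * δ q, q ^ 2, by rw [map_pow]; exact pow_ne_zero _ hq, ?_, ?_⟩
  · rw [jD_div _ _ _ hq]; simp [h1]
  · rw [jD_div _ _ _ (pow_ne_zero 2 hq)]
    simp only [pow_two, map_sub, map_mul, D.leibniz, derivative_mul, map_add, smul_eq_mul, ← h1, h3]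
    field_simp
    ring

lemma jrel_zero {t z : E} (ht : Transcendental K t) (hz : z ∈ K ⊔ Subfield.closure {t})
    (h : JRel K t z 0) : z ∈ K := by
  obtain ⟨p, q, hq, hco, rfl⟩ := jmem_simple hz
  have h2 := jrel_unique ht h ⟨p, q, hq, rfl, rfl⟩
  have e : derivative p * q = p * derivative q := by
    apply jinj ht
    have := h2.symm
    rw [div_eq_zero_iff] at this
    have := this.resolve_right (pow_ne_zero 2 hq)
    rw [map_mul, map_mul]
    linear_combination this
  have key : ∀ f : K[X], f ∣ derivative f → f.natDegree = 0 := by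
    intro f hf
    by_contra hne
    have hf0 : f ≠ 0 := by rintro rfl; simp at hne
    have := eq_zero_of_dvd_of_degree_lt hf (degree_derivative_lt hf0)
    exact hne (derivative_eq_zero.1 this)
  have hqd : q.natDegree = 0 :=
    key q (hco.symm.dvd_of_dvd_mul_left ⟨derivative p, by rw [← e]; ring⟩)
  have hpd : p.natDegree = 0 :=
    key p (hco.dvd_of_dvd_mul_right ⟨derivative q, e⟩)
  exact div_mem (jnatDegree_zero_mem hpd) (jnatDegree_zero_mem hqd)

lemma jrel_poly {t : E} (p : K[X]) : JRel K t (aeval t p) (aeval t (derivative p)) :=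
  ⟨p, 1, by simp, by simp, by simp⟩

/-- Poles of derivatives are never simple. -/
lemma jPL {R : Type*} [CommRing R] [IsDomain R] [WfDvdMonoid R] (ι : R →+* E)
    (hι : Function.Injective ι) (hδ : ∀ r, ∃ s, ι s = D (ι r)) {P : R} (hP : Prime P)
    (hPn : ∀ n : ℕ, P ∣ (n : R) → n = 0)
    (hPD : ∀ s, ι s = D (ι P) → ¬ P ∣ s) {a b u v : R} (hb : b ≠ 0) (hv : ¬ P ∣ v)
    (h : D (ι a / ι b) * (ι P * ι v) = ι u) : P ∣ u := by
  by_cases ha : a = 0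
  · subst ha
    simp at h
    rw [hι (show ι u = ι 0 by rw [map_zero, ← h])]
    exact dvd_zero _
  obtain ⟨n, b', hb', rfl⟩ := WfDvdMonoid.max_power_factor hb hP.irreducible
  obtain ⟨m, a', ha', rfl⟩ := WfDvdMonoid.max_power_factor ha hP.irreducible
  have hP0 : ι P ≠ 0 := by rw [Ne, map_eq_zero_iff ι hι]; exact hP.ne_zero
  have hb'0 : ι b' ≠ 0 := by
    rw [Ne, map_eq_zero_iff ι hι]; rintro rfl; exact hb' (dvd_zero _)
  obtain ⟨P1, hP1⟩ := hδ P
  have hP1' := hPD P1 hP1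
  obtain ⟨b1, hb1⟩ := hδ b'
  rcases le_or_gt n m with hnm | hnm
  · obtain ⟨j, rfl⟩ := Nat.exists_eq_add_of_le hnm
    have e : ι (P ^ (n + j) * a') / ι (P ^ n * b') = ι (P ^ j * a') / ι b' := by
      simp only [map_mul, map_pow, pow_add]
      field_simp
    rw [e, jD_div _ _ _ hb'0] at h
    obtain ⟨c1, hc1⟩ := hδ (P ^ j * a')
    rw [← hc1, ← hb1] at h
    have h' : P * (v * (c1 * b' - P ^ j * a' * b1)) = u * b' ^ 2 := by
      apply hι
      simp only [map_mul, map_sub, map_pow] at h ⊢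
      rw [← h]
      field_simp
    have : P ∣ u * b' ^ 2 := ⟨_, h'.symm⟩
    exact (hP.dvd_or_dvd this).resolve_right fun h => hb' (hP.dvd_of_dvd_pow h)
  · exfalso
    obtain ⟨j, rfl⟩ := Nat.exists_eq_add_of_lt hnm
    have e : ι (P ^ m * a') / ι (P ^ (m + j + 1) * b') = ι a' / ι (P ^ (j + 1) * b') := by
      simp only [map_mul, map_pow, pow_add]
      field_simp
    rw [e, jD_div _ _ _ (by simp only [map_mul, map_pow]; positivity)] at h
    obtain ⟨a1, ha1⟩ := hδ a'
    have hD : D (ι (P ^ (j + 1) * b')) = ι (P ^ (j + 1) * b1 + b' * ((j + 1 : ℕ) * P ^ j * P1)) := by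
      simp only [map_mul, map_pow, D.leibniz, D.leibniz_pow, map_add, hP1, hb1, smul_eq_mul,
        nsmul_eq_mul, map_natCast, Nat.add_sub_cancel]
      ring
    rw [hD, ← ha1] at h
    have h' : v * (a1 * (P * b') - a' * (P * b1 + b' * ((j + 1 : ℕ) * P1))) =
        u * P ^ (j + 1) * b' ^ 2 := by
      apply hι
      simp only [map_mul, map_sub, map_pow, map_add, pow_succ] at h ⊢
      rw [← h]
      field_simp
    have h2 : P ∣ v * a' * b' * (j + 1 : ℕ) * P1 :=
      ⟨v * (a1 * b' - a' * b1) - u * P ^ j * b' ^ 2, by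
        rw [pow_succ] at h'
        linear_combination -h'⟩
    rcases hP.dvd_or_dvd h2 with h2 | h2
    · rcases hP.dvd_or_dvd h2 with h2 | h2
      · rcases hP.dvd_or_dvd h2 with h2 | h2
        · rcases hP.dvd_or_dvd h2 with h2 | h2
          · exact hv h2
          · exact ha' h2
        · exact hb' h2
      · exact absurd (hPn _ h2) (Nat.succ_ne_zero j)
    · exact hP1' h2

section phi
variable {F : Subfield E} {ι : Type*} {x : ι → E} {t : E} {γ : ι → F} {k : ι → K}

/-- The substitution `x_i = k_i + γ_i t`. -/
noncomputable def jphi (hFK : F ≤ K) (γ : ι → F) (k : ι → K) : MvPolynomial ι F →+* K[X] :=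
  MvPolynomial.eval₂Hom (C.comp (Subfield.inclusion hFK))
    (fun i => C (k i) + C (Subfield.inclusion hFK (γ i)) * X)

/-- The directional derivative. -/
noncomputable def jpd (γ : ι → F) : Derivation F (MvPolynomial ι F) (MvPolynomial ι F) :=
  MvPolynomial.mkDerivation F (fun i => MvPolynomial.C (γ i))

lemma jphi_aeval (hFK : F ≤ K) (hx : ∀ i, x i = k i + γ i * t) (f : MvPolynomial ι F) :
    aeval t (jphi hFK γ k f) = MvPolynomial.aeval x f := by
  induction f using MvPolynomial.induction_on with
  | C a =>
    simp only [jphi, MvPolynomial.eval₂Hom_C, RingHom.comp_apply, aeval_C, MvPolynomial.aeval_C]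
    rfl
  | add p q hp hq => simp only [map_add, hp, hq]
  | mul_X p i hp =>
    simp only [map_mul, hp, MvPolynomial.aeval_X, hx]
    congr 1
    simp only [jphi, MvPolynomial.eval₂Hom_X', map_add, map_mul, aeval_C, aeval_X]
    rfl

lemma jphi_derivative (hFK : F ≤ K) (f : MvPolynomial ι F) :
    derivative (jphi hFK γ k f) = jphi hFK γ k (jpd γ f) := by
  induction f using MvPolynomial.induction_on with
  | C a =>
    simp [jphi]
  | add p q hp hq => simp only [map_add, hp, hq]
  | mul_X p i hp =>
    simp only [map_mul, derivative_mul, hp, (jpd γ).leibniz, map_add, smul_eq_mul]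
    have e : derivative (jphi hFK γ k (MvPolynomial.X i)) =
        jphi hFK γ k (jpd γ (MvPolynomial.X i)) := by
      simp [jphi, jpd, MvPolynomial.mkDerivation_X]
    rw [e]
    ring

lemma jaeval_inj (hind : AlgebraicIndependent F x) {f g : MvPolynomial ι F}
    (h : MvPolynomial.aeval x f = MvPolynomial.aeval x g) : f = g := hind h

lemma jphi_inj (hFK : F ≤ K) (hx : ∀ i, x i = k i + γ i * t) (hind : AlgebraicIndependent F x)
    {f g : MvPolynomial ι F} (h : jphi hFK γ k f = jphi hFK γ k g) : f = g := by
  apply jaeval_inj hind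
  rw [← jphi_aeval hFK hx, h, jphi_aeval hFK hx]

lemma jphi_ne_zero (hFK : F ≤ K) (hx : ∀ i, x i = k i + γ i * t) (hind : AlgebraicIndependent F x)
    {f : MvPolynomial ι F} (h : f ≠ 0) : jphi hFK γ k f ≠ 0 := fun h' =>
  h (jphi_inj (γ := γ) (k := k) hFK hx hind (by rw [h', map_zero]))

lemma jphi_map {G : Subfield E} (hFG : F ≤ G) (hGK : G ≤ K) (kG : ι → G)
    (f : MvPolynomial ι F) :
    (jphi hFG γ kG f).map (Subfield.inclusion hGK) =
      jphi (hFG.trans hGK) γ (fun i => Subfield.inclusion hGK (kG i)) f := by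
  induction f using MvPolynomial.induction_on with
  | C a => simp [jphi]; rfl
  | add p q hp hq => simp only [map_add, Polynomial.map_add, hp, hq]
  | mul_X p i hp =>
    simp only [map_mul, Polynomial.map_mul, hp]
    congr 1
    simp [jphi]
    rfl

/-- Divisor of something of degree zero. -/
lemma jnatDegree_of_dvd {p q : K[X]} (h : p ∣ q) (hq : q ≠ 0) (hq0 : q.natDegree = 0) :
    p.natDegree = 0 := by
  have := natDegree_le_of_dvd h hq
  omega

lemma jCT0 {G : Subfield E} (hFG : F ≤ G) {k : ι → G}
    (ht : Transcendental G t) (a : ι) (hta : t = x a)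
    (hx : ∀ i, x i = k i + γ i * t) (hind : AlgebraicIndependent F x)
    (hG : G ≤ F ⊔ Subfield.closure (Set.range fun i => (k i : E)))
    {P Q : MvPolynomial ι F} (hP : Irreducible P) (hPd : (jphi hFG γ k P).natDegree ≠ 0)
    (hPQ : ¬ P ∣ Q) : IsCoprime (jphi hFG γ k P) (jphi hFG γ k Q) := by
  have hdeg0 : ∀ d : MvPolynomial ι F, MvPolynomial.aeval x d ∈ G →
      (jphi hFG γ k d).natDegree = 0 := fun d hd =>
    jmem_natDegree_zero ht (by rw [jphi_aeval hFG hx]; exact hd)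
  have hfr : ∀ g ∈ F ⊔ Subfield.closure (Set.range fun i => (k i : E)),
      ∃ n d : MvPolynomial ι F, MvPolynomial.aeval x n ∈ G ∧ MvPolynomial.aeval x d ∈ G ∧
        MvPolynomial.aeval x d ≠ 0 ∧ g * MvPolynomial.aeval x d = MvPolynomial.aeval x n := by
    intro g hg
    have e : F ⊔ Subfield.closure (Set.range fun i => (k i : E)) =
        Subfield.closure (↑F ∪ (Set.range fun i => (k i : E))) := by
      rw [Subfield.closure_union, Subfield.closure_eq]
    rw [e] at hg
    induction hg using Subfield.closure_induction with
    | mem g hg =>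
      rcases hg with hg | ⟨i, rfl⟩
      · refine ⟨MvPolynomial.C ⟨g, hg⟩, 1, ?_, by simp, by simp, ?_⟩
        · rw [MvPolynomial.aeval_C]; exact hFG hg
        · rw [MvPolynomial.aeval_C]; simp; rfl
      · have e : (k i : E) = MvPolynomial.aeval x (MvPolynomial.X i -
            MvPolynomial.C (γ i) * MvPolynomial.X a : MvPolynomial ι F) := by
          simp only [map_sub, map_mul, MvPolynomial.aeval_X, MvPolynomial.aeval_C]
          change _ = _ - (γ i : E) * _
          rw [← hta, hx i]
          ring
        refine ⟨MvPolynomial.X i - MvPolynomial.C (γ i) * MvPolynomial.X a, 1, ?_, by simp, by simp,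
          by rw [map_one, mul_one]; exact e⟩
        rw [← e]; exact (k i).2
    | one => exact ⟨1, 1, by simp, by simp, by simp, by simp⟩
    | add g h _ _ ihg ihh =>
      obtain ⟨n, d, h1, h2, h3, h4⟩ := ihg
      obtain ⟨n', d', h1', h2', h3', h4'⟩ := ihh
      refine ⟨n * d' + n' * d, d * d', ?_, ?_, ?_, ?_⟩ <;> simp only [map_add, map_mul]
      · exact add_mem (mul_mem h1 h2') (mul_mem h1' h2)
      · exact mul_mem h2 h2'
      · exact mul_ne_zero h3 h3'
      · rw [← h4, ← h4']; ring
    | neg g _ ihg =>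
      obtain ⟨n, d, h1, h2, h3, h4⟩ := ihg
      refine ⟨-n, d, ?_, h2, h3, ?_⟩ <;> rw [map_neg]
      · exact neg_mem h1
      · rw [← h4]; ring
    | inv g _ ihg =>
      obtain ⟨n, d, h1, h2, h3, h4⟩ := ihg
      by_cases hg : g = 0
      · exact ⟨0, 1, by simp, by simp, by simp, by simp [hg]⟩
      · refine ⟨d, n, h2, h1, ?_, ?_⟩ <;> rw [← h4]
        · exact mul_ne_zero hg h3
        · field_simp
    | mul g h _ _ ihg ihh =>
      obtain ⟨n, d, h1, h2, h3, h4⟩ := ihg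
      obtain ⟨n', d', h1', h2', h3', h4'⟩ := ihh
      refine ⟨n * n', d * d', ?_, ?_, ?_, ?_⟩ <;> simp only [map_mul]
      · exact mul_mem h1 h1'
      · exact mul_mem h2 h2'
      · exact mul_ne_zero h3 h3'
      · rw [← h4, ← h4']; ring
  have hfrX : ∀ p : G[X], ∃ n d : MvPolynomial ι F, MvPolynomial.aeval x d ∈ G ∧ d ≠ 0 ∧
        p * jphi hFG γ k d = jphi hFG γ k n := by
    intro p
    induction p using Polynomial.induction_on' with
    | add p q hp hq =>
      obtain ⟨n, d, h2, h3, h4⟩ := hp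
      obtain ⟨n', d', h2', h3', h4'⟩ := hq
      refine ⟨n * d' + n' * d, d * d', ?_, mul_ne_zero h3 h3', ?_⟩ <;>
        simp only [map_add, map_mul]
      · exact mul_mem h2 h2'
      · rw [← h4, ← h4']; ring
    | monomial j g =>
      obtain ⟨n, d, h1, h2, h3, h4⟩ := hfr g (hG g.2)
      refine ⟨n * MvPolynomial.X a ^ j, d, h2, by rintro rfl; simp at h3, ?_⟩
      apply jinj ht
      rw [map_mul, jphi_aeval hFG hx, jphi_aeval hFG hx, aeval_monomial, map_mul, ← h4, map_pow,
        MvPolynomial.aeval_X, ← hta]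
      change (g : E) * _ * _ = _
      ring
  have hPp : Prime P := hP.prime
  have hunit : ∀ d, MvPolynomial.aeval x d ∈ G → d ≠ 0 → IsUnit (jphi hFG γ k d) := by
    intro d hd hd0
    rw [Polynomial.isUnit_iff_degree_eq_zero]
    rw [degree_eq_natDegree (jphi_ne_zero hFG hx hind hd0), hdeg0 d hd]
    rfl
  have hPnd : ∀ d, MvPolynomial.aeval x d ∈ G → d ≠ 0 → ¬ P ∣ d := by
    intro d hd hd0 hdv
    exact hPd (jnatDegree_of_dvd (map_dvd (jphi hFG γ k) hdv) (jphi_ne_zero hFG hx hind hd0)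
      (hdeg0 d hd))
  have hback : ∀ f, jphi hFG γ k P ∣ jphi hFG γ k f → P ∣ f := by
    rintro f ⟨r, hr⟩
    obtain ⟨n, d, h2, h3, h4⟩ := hfrX r
    have : f * d = P * n := by
      apply jphi_inj (γ := γ) (k := k) hFG hx hind
      rw [map_mul, map_mul, ← h4, hr]; ring
    exact (hPp.dvd_or_dvd ⟨n, this⟩).resolve_right (hPnd d h2 h3)
  have hprime : Prime (jphi hFG γ k P) := by
    refine ⟨jphi_ne_zero hFG hx hind hP.ne_zero, ?_, ?_⟩
    · intro hu
      exact hPd (natDegree_eq_zero_of_isUnit hu)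
    · intro p q hpq
      obtain ⟨n, d, h2, h3, h4⟩ := hfrX p
      obtain ⟨n', d', h2', h3', h4'⟩ := hfrX q
      have h5 : P ∣ n * n' := by
        apply hback
        rw [map_mul, ← h4, ← h4']
        exact (hpq.mul_right (jphi hFG γ k d * jphi hFG γ k d')).trans (by
          apply dvd_of_eq; ring)
      rcases hPp.dvd_or_dvd h5 with h5 | h5
      · left
        have := map_dvd (jphi hFG γ k) h5
        rw [← h4] at this
        exact (hunit d h2 h3).dvd_mul_right.1 this
      · right
        have := map_dvd (jphi hFG γ k) h5
        rw [← h4'] at this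
        exact (hunit d' h2' h3').dvd_mul_right.1 this
  rw [hprime.coprime_iff_not_dvd]
  exact fun h => hPQ (hback _ h)

lemma jCT (hFK : F ≤ K) (ht : Transcendental K t) (a : ι) (hta : t = x a)
    (hx : ∀ i, x i = k i + γ i * t) (hind : AlgebraicIndependent F x)
    {P Q : MvPolynomial ι F} (hP : Irreducible P) (hPd : (jphi hFK γ k P).natDegree ≠ 0)
    (hPQ : ¬ P ∣ Q) : IsCoprime (jphi hFK γ k P) (jphi hFK γ k Q) := by
  set G := F ⊔ Subfield.closure (Set.range fun i => (k i : E)) with hGdef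
  have hFG : F ≤ G := le_sup_left
  have hGK : G ≤ K := sup_le hFK (by rw [Subfield.closure_le]; rintro _ ⟨i, rfl⟩; exact (k i).2)
  let kG : ι → G := fun i => ⟨k i, (le_sup_right : Subfield.closure _ ≤ G)
    (Subfield.subset_closure ⟨i, rfl⟩)⟩
  have htG : Transcendental G t := by
    rw [transcendental_iff] at ht ⊢
    intro p hp
    have := ht (p.map (Subfield.inclusion hGK)) (by
      rw [aeval_def, eval₂_map]; exact hp)
    exact (Polynomial.map_eq_zero _).1 this
  have e : ∀ f, jphi hFK γ k f = (jphi hFG γ kG f).map (Subfield.inclusion hGK) := fun f =>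
    (jphi_map hFG hGK kG f).symm
  rw [e P, natDegree_map] at hPd
  rw [e, e]
  exact (jCT0 hFG htG a hta (k := kG) hx hind le_rfl hP hPd hPQ).map
    (Polynomial.mapRingHom (Subfield.inclusion hGK))

end phi

section coord
variable {F : Subfield E} {ι : Type*} {x : ι → E}

lemma jadj (S : Set E) : (IntermediateField.adjoin F S).toSubfield = F ⊔ Subfield.closure S := by
  rw [IntermediateField.adjoin_toSubfield, Subfield.closure_union]
  have : Set.range (algebraMap F E) = (F : Set E) := by
    ext a; constructor
    · rintro ⟨b, rfl⟩; exact b.2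
    · intro h; exact ⟨⟨a, h⟩, rfl⟩
  rw [this, Subfield.closure_eq]

lemma jfrac {r : E} (hr : r ∈ F ⊔ Subfield.closure (Set.range x)) :
    ∃ a b : MvPolynomial ι F, MvPolynomial.aeval x b ≠ 0 ∧
      r = MvPolynomial.aeval x a / MvPolynomial.aeval x b := by
  rw [← jadj] at hr
  obtain ⟨a, b, h⟩ := (IntermediateField.mem_adjoin_range_iff F x r).1 hr
  by_cases hb : MvPolynomial.aeval x b = 0
  · exact ⟨0, 1, by simp, by rw [h, hb]; simp⟩
  · exact ⟨a, b, hb, h⟩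

lemma jaeval_memF (f : MvPolynomial ι F) :
    MvPolynomial.aeval x f ∈ F ⊔ Subfield.closure (Set.range x) := by
  rw [← jadj]
  exact (IntermediateField.mem_adjoin_range_iff F x _).2 ⟨f, 1, by simp⟩

lemma jmvD (hF : JStable D F) (hx : ∀ i, D (x i) ∈ F) (f : MvPolynomial ι F) :
    ∃ g : MvPolynomial ι F, MvPolynomial.aeval x g = D (MvPolynomial.aeval x f) := by
  induction f using MvPolynomial.induction_on with
  | C a =>
    refine ⟨MvPolynomial.C ⟨D a, hF _ a.2⟩, ?_⟩
    rw [MvPolynomial.aeval_C, MvPolynomial.aeval_C]; rfl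
  | add p q hp hq =>
    obtain ⟨g, hg⟩ := hp
    obtain ⟨g', hg'⟩ := hq
    exact ⟨g + g', by simp only [map_add, hg, hg']⟩
  | mul_X p i hp =>
    obtain ⟨g, hg⟩ := hp
    refine ⟨g * MvPolynomial.X i + p * MvPolynomial.C ⟨D (x i), hx i⟩, ?_⟩
    simp only [map_add, map_mul, hg, MvPolynomial.aeval_X, MvPolynomial.aeval_C, D.leibniz,
      smul_eq_mul]
    change _ + _ * D (x i) = _
    ring

open scoped IntermediateField.algebraAdjoinAdjoin in
lemma jcoord [DecidableEq ι] (hF : JStable D F) (hx : ∀ i, D (x i) ∈ F)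
    (hind : AlgebraicIndependent F x) (c : ι) :
    ∃ (G : Subfield E) (_ : F ≤ G) (k : ι → G), JStable D G ∧ Transcendental G (x c) ∧
      ∀ i, x i = k i + ((Pi.single c 1 : ι → F) i : E) * x c := by
  have hFG : F ≤ (IntermediateField.adjoin F (x '' {c}ᶜ)).toSubfield := by
    rw [jadj]; exact le_sup_left
  have hm : ∀ i, i ≠ c → x i ∈ (IntermediateField.adjoin F (x '' {c}ᶜ)).toSubfield := fun i hi =>
    IntermediateField.subset_adjoin F _ ⟨i, hi, rfl⟩
  refine ⟨(IntermediateField.adjoin F (x '' {c}ᶜ)).toSubfield, hFG,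
    fun i => if h : i = c then 0 else ⟨x i, hm i h⟩, ?_, ?_, ?_⟩
  · rw [jadj]
    apply jstable_sup hF
    rintro _ ⟨i, -, rfl⟩
    exact (le_sup_left : F ≤ _) (hx i)
  · have := hind.transcendental_adjoin (s := {c}ᶜ) (i := c) (by simp)
    intro h
    apply this
    rw [IsFractionRing.isAlgebraic_iff (Algebra.adjoin F (x '' {c}ᶜ))
      (IntermediateField.adjoin F (x '' {c}ᶜ)) E]
    exact h
  · intro i
    by_cases h : i = c
    · subst h; simp
    · simp [h]

lemma jpd_single [DecidableEq ι] (c : ι) :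
    jpd (F := F) (Pi.single c 1) = MvPolynomial.pderiv c := by
  apply MvPolynomial.derivation_ext
  intro i
  rw [jpd, MvPolynomial.mkDerivation_X, MvPolynomial.pderiv_X]
  by_cases h : i = c
  · subst h; simp
  · simp [h]

lemma jCD [DecidableEq ι] (hF : JStable D F) (hN : ∀ a, D a = 0 → a ∈ F) (hx : ∀ i, D (x i) ∈ F)
    (hind : AlgebraicIndependent F x) {c : ι} {P s : MvPolynomial ι F}
    (hP : MvPolynomial.pderiv c P ≠ 0)
    (hs : MvPolynomial.aeval x s = D (MvPolynomial.aeval x P)) : ¬ P ∣ s := by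
  intro h
  obtain ⟨G, hFG, k, hG, ht, hk⟩ := jcoord hF hx hind c
  have h0 := jU hG (fun a ha => hFG (hN a ha)) ht
    (p := jphi hFG (Pi.single c 1) k P) (q := jphi hFG (Pi.single c 1) k s)
    (by rw [jphi_aeval hFG hk, jphi_aeval hFG hk, hs]) (hFG (hx c))
    (map_dvd (jphi hFG (Pi.single c 1) k) h)
  apply hP
  rw [← jpd_single]
  apply jphi_inj (γ := Pi.single c 1) (k := k) hFG hk hind
  rw [← jphi_derivative, derivative_of_natDegree_zero h0, map_zero]

lemma jdvd_zero [DecidableEq ι] (hF : JStable D F) (hx : ∀ i, D (x i) ∈ F)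
    (hind : AlgebraicIndependent F x) {c : ι} {P N : MvPolynomial ι F}
    (hP : MvPolynomial.pderiv c P ≠ 0) (hN : MvPolynomial.pderiv c N = 0) (hPN : P ∣ N) :
    N = 0 := by
  by_contra hN0
  obtain ⟨G, hFG, k, hG, ht, hk⟩ := jcoord hF hx hind c
  have h1 : (jphi hFG (Pi.single c 1) k N).natDegree = 0 := by
    apply Polynomial.derivative_eq_zero.1
    rw [jphi_derivative, jpd_single, hN, map_zero]
  have h0 := jnatDegree_of_dvd (map_dvd (jphi hFG (Pi.single c 1) k) hPN)
    (jphi_ne_zero hFG hk hind hN0) h1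
  apply hP
  rw [← jpd_single]
  apply jphi_inj (γ := Pi.single c 1) (k := k) hFG hk hind
  rw [← jphi_derivative, derivative_of_natDegree_zero h0, map_zero]

lemma jpd_comm (γ : ι → F) (c : ι) (f : MvPolynomial ι F) :
    MvPolynomial.pderiv c (jpd γ f) = jpd γ (MvPolynomial.pderiv c f) := by
  classical
  induction f using MvPolynomial.induction_on with
  | C a => simp [jpd]
  | add p q hp hq => simp only [map_add, hp, hq]
  | mul_X p i hp =>
    have e1 : MvPolynomial.pderiv c (jpd γ (MvPolynomial.X i : MvPolynomial ι F)) = 0 := by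
      simp [jpd, MvPolynomial.mkDerivation_X]
    have e2 : jpd γ (MvPolynomial.pderiv c (MvPolynomial.X i : MvPolynomial ι F)) = 0 := by
      rw [MvPolynomial.pderiv_X]
      by_cases h : i = c
      · subst h; simp
      · simp [h]
    simp only [Derivation.leibniz, map_add, smul_eq_mul, hp, e1, e2]
    ring

end coord

section OS

lemma jpf {R κ : Type*} [CommRing R] [Fintype κ] [DecidableEq κ] (g : R →+* E) (N d : κ → R)
    (hd : ∀ j, g (d j) ≠ 0) (i : κ) :
    ∃ T, (∑ j, g (N j) / g (d j)) * (g (d i) * g (∏ j ∈ Finset.univ.erase i, d j)) =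
      g (N i * (∏ j ∈ Finset.univ.erase i, d j) + d i * T) := by
  have key : ∀ s : Finset κ, ∃ T, (∑ j ∈ s, g (N j) / g (d j)) * g (∏ j ∈ s, d j) = g T := by
    intro s
    induction s using Finset.induction_on with
    | empty => exact ⟨0, by simp⟩
    | insert a s ha ih =>
      obtain ⟨T, hT⟩ := ih
      refine ⟨N a * (∏ j ∈ s, d j) + d a * T, ?_⟩
      rw [Finset.sum_insert ha, Finset.prod_insert ha, map_add, map_mul, map_mul, map_mul, ← hT]
      have := hd a
      field_simp
  obtain ⟨T, hT⟩ := key (Finset.univ.erase i)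
  refine ⟨T, ?_⟩
  rw [← Finset.add_sum_erase _ _ (Finset.mem_univ i), map_add, map_mul, map_mul, ← hT]
  have := hd i
  field_simp

/-- The data of the theorem. -/
structure JData {κ ι : Type*} (D : Derivation ℤ E E) (F : Subfield E) (x : ι → E)
    (A B Cp : κ → MvPolynomial ι F) (y : κ → E) : Prop where
  hF : JStable D F
  hN : ∀ a, D a = 0 → a ∈ F
  hx : ∀ i, D (x i) ∈ F
  hind : AlgebraicIndependent F x
  hAC : ∀ i, ¬ Cp i ∣ A i
  hirr : ∀ i, Irreducible (Cp i)
  hCC : ∀ i j, i ≠ j → ¬ Cp i ∣ Cp j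
  hCB : ∀ i j, ¬ Cp i ∣ B j
  hC2 : ∀ i, ∃ c : ι, MvPolynomial.pderiv c (Cp i) ≠ 0 ∧
      MvPolynomial.pderiv c (A i) = 0 ∧ MvPolynomial.pderiv c (B i) = 0
  hy : ∀ i, D (y i) = MvPolynomial.aeval x (A i) /
        (MvPolynomial.aeval x (Cp i) * MvPolynomial.aeval x (B i))

variable {F : Subfield E} {κ ι : Type*} [Fintype κ] [DecidableEq κ] [DecidableEq ι]
  {x : ι → E} {A B Cp : κ → MvPolynomial ι F} {y : κ → E}

lemma JData.hB0 (h : JData D F x A B Cp y) (j : κ) : B j ≠ 0 := fun e =>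
  h.hCB j j (by rw [e]; exact dvd_zero _)

lemma JData.hA0 (h : JData D F x A B Cp y) (j : κ) : A j ≠ 0 := fun e =>
  h.hAC j (by rw [e]; exact dvd_zero _)

lemma JData.hprod (h : JData D F x A B Cp y) (i : κ) (n : ℕ) :
    ¬ Cp i ∣ ∏ j ∈ Finset.univ.erase i, (Cp j * B j ^ n) := by
  rw [(h.hirr i).prime.dvd_finsetProd_iff]
  rintro ⟨j, hj, hd⟩
  rcases (h.hirr i).prime.dvd_or_dvd hd with h1 | h1
  · exact h.hCC i j (Finset.ne_of_mem_erase hj).symm h1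
  · exact h.hCB i j ((h.hirr i).prime.dvd_of_dvd_pow h1)

lemma jae0 (hind : AlgebraicIndependent F x) {f : MvPolynomial ι F} (hf : f ≠ 0) :
    MvPolynomial.aeval x f ≠ 0 := fun e => hf (jaeval_inj hind (by rw [e, map_zero]))

lemma jOSa (h : JData D F x A B Cp y) (hFK : F ≤ K) (hK : JStable D K) (a : ι)
    (ht : Transcendental K (x a)) {γ : ι → F} {k : ι → K} 
    (hxk : ∀ i, x i = k i + γ i * x a) (c : κ → F) (hc : ∀ j, D (c j : E) = 0)
    (hz : ∑ j, (c j : E) * y j ∈ K ⊔ Subfield.closure {x a}) (i : κ) (hi : c i ≠ 0) :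
    (jphi hFK γ k (Cp i)).natDegree = 0 := by
  by_contra hdeg
  set φ := jphi hFK γ k with hφ
  set t := x a with hta
  have hN : ∀ b, D b = 0 → b ∈ K := fun b hb => hFK (h.hN b hb)
  have htK : D t ∈ K := hFK (h.hx a)
  have hne : ∀ {f}, f ≠ 0 → φ f ≠ 0 := fun {f} hf => jphi_ne_zero hFK hxk h.hind hf
  have hC0 : ∀ j, Cp j ≠ 0 := fun j => (h.hirr j).ne_zero
  have hcop : ∀ {Q}, ¬ Cp i ∣ Q → IsCoprime (φ (Cp i)) (φ Q) := fun {Q} hQ =>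
    jCT hFK ht a hta hxk h.hind (h.hirr i) hdeg hQ
  obtain ⟨P, hP, Ct, hCt⟩ := WfDvdMonoid.exists_irreducible_factor
    (fun hu => hdeg (natDegree_eq_zero_of_isUnit hu)) (hne (hC0 i))
  have hPp : Prime P := hP.prime
  have hPdvd : P ∣ φ (Cp i) := ⟨Ct, hCt⟩
  have hPn : ∀ {Q}, ¬ Cp i ∣ Q → ¬ P ∣ φ Q := fun {Q} hQ hd =>
    hPp.not_isUnit ((hcop hQ).isUnit_of_dvd' hPdvd hd)
  have hCd : ¬ Cp i ∣ jpd γ (Cp i) := by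
    intro hd
    have h1 := map_dvd φ hd
    rw [hφ, ← jphi_derivative] at h1
    apply hdeg
    by_contra h2
    have h3 : derivative (φ (Cp i)) ≠ 0 := fun e => h2 (Polynomial.derivative_eq_zero.1 e)
    exact absurd (natDegree_le_of_dvd h1 h3) (not_le.2 (natDegree_derivative_lt h2))
  have hPCt : ¬ P ∣ Ct := by
    rintro ⟨W, rfl⟩
    apply hPn hCd
    rw [hφ, ← jphi_derivative, ← hφ, hCt]
    simp only [derivative_mul]
    exact ⟨derivative P * W + (derivative P * W + P * derivative W), by ring⟩
  obtain ⟨p, q, hq, -, hzpq⟩ := jmem_simple hz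
  have hgi : Function.Injective (aeval t : K[X] →ₐ[K] E).toRingHom := fun p q h => jinj ht h
  have hgz : ∀ {f : K[X]}, f ≠ 0 → (aeval t : K[X] →ₐ[K] E).toRingHom f ≠ 0 := fun {f} hf e =>
    hf (hgi (by rw [e, map_zero]))
  obtain ⟨T, hT⟩ := jpf (aeval t : K[X] →ₐ[K] E).toRingHom
    (fun j => φ (MvPolynomial.C (c j) * A j)) (fun j => φ (Cp j * B j ^ 1))
    (fun j => hgz (hne (mul_ne_zero (hC0 j) (pow_ne_zero _ (h.hB0 j))))) i
  have hDz : D (∑ j, (c j : E) * y j) =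
      ∑ j, (aeval t : K[X] →ₐ[K] E).toRingHom (φ (MvPolynomial.C (c j) * A j)) /
        (aeval t : K[X] →ₐ[K] E).toRingHom (φ (Cp j * B j ^ 1)) := by
    rw [map_sum]
    refine Finset.sum_congr rfl fun j _ => ?_
    change _ = aeval t _ / aeval t _
    rw [D.leibniz, hc, smul_zero, add_zero, smul_eq_mul, h.hy, hφ, jphi_aeval hFK hxk,
      jphi_aeval hFK hxk, pow_one, map_mul, map_mul, MvPolynomial.aeval_C]
    change _ = (c j : E) * _ / _
    ring
  rw [← hDz] at hT
  have hM : (∏ j ∈ Finset.univ.erase i, φ (Cp j * B j ^ 1)) =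
      φ (∏ j ∈ Finset.univ.erase i, (Cp j * B j ^ 1)) := (map_prod φ _ _).symm
  rw [hM] at hT
  set M := ∏ j ∈ Finset.univ.erase i, (Cp j * B j ^ 1) with hMdef
  have hPM : ¬ P ∣ φ M := hPn (h.hprod i 1)
  have := jPL (D := D) (aeval t : K[X] →ₐ[K] E).toRingHom hgi
    (fun r => by
      obtain ⟨δ, h1, -, -⟩ := exists_jdl hK t htK
      exact ⟨δ r, h1 r⟩) hPp
    (fun n hn => by
      by_contra h0
      apply hPp.not_isUnit
      refine isUnit_of_dvd_unit hn ?_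
      rw [← map_natCast (C : K →+* K[X])]
      exact (IsUnit.mk0 _ (by exact_mod_cast h0)).map C)
    (fun s hs hd => by
      have := jU hK hN ht hs htK hd
      exact (natDegree_pos_iff_degree_pos.2 (degree_pos_of_irreducible hP)).ne' this)
    (a := p) (b := q) (u := φ (MvPolynomial.C (c i) * A i) * φ M + φ (Cp i * B i ^ 1) * T)
    (v := Ct * φ (B i) * φ M)
    (by rintro rfl; simp at hq)
    (fun hd => by
      rcases hPp.dvd_or_dvd hd with hd | hd
      · rcases hPp.dvd_or_dvd hd with hd | hd
        · exact hPCt hd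
        · exact hPn (h.hCB i i) hd
      · exact hPM hd)
    (by
      rw [← hT]
      have e : (aeval t : K[X] →ₐ[K] E).toRingHom p / (aeval t : K[X] →ₐ[K] E).toRingHom q =
        ∑ j, (c j : E) * y j := hzpq.symm
      rw [e, pow_one, map_mul φ, hCt]
      simp only [map_mul]
      ring)
  have h2 : P ∣ φ (MvPolynomial.C (c i) * A i) * φ M := by
    refine (dvd_add_left ?_).1 this
    rw [map_mul]
    exact (hPdvd.mul_right _).mul_right _
  rcases hPp.dvd_or_dvd h2 with h2 | h2
  · refine hPn (fun hd => ?_) h2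
    rcases (h.hirr i).prime.dvd_or_dvd hd with h3 | h3
    · exact (h.hirr i).not_isUnit (isUnit_of_dvd_unit h3 ((IsUnit.mk0 _ hi).map MvPolynomial.C))
    · exact h.hAC i h3
  · exact hPM h2


lemma jdeg {c e : K} {a b : K[X]} (ha : a ≠ 0) (hb : b ≠ 0)
    (h : C c * (derivative a * b - a * derivative b) = C e * (a * b)) : e = 0 := by
  by_contra he
  have h1 : (C e * (a * b)).degree = a.degree + b.degree := by
    rw [degree_C_mul he, degree_mul]
  have h2 : (derivative a * b).degree < a.degree + b.degree := by
    rw [degree_mul]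
    exact WithBot.add_lt_add_right (by rwa [Ne, degree_eq_bot]) (degree_derivative_lt ha)
  have h3 : (a * derivative b).degree < a.degree + b.degree := by
    rw [degree_mul]
    exact WithBot.add_lt_add_left (by rwa [Ne, degree_eq_bot]) (degree_derivative_lt hb)
  have h4 : (C c * (derivative a * b - a * derivative b)).degree < a.degree + b.degree := by
    refine lt_of_le_of_lt ?_ (lt_of_le_of_lt (degree_sub_le _ _) (max_lt h2 h3))
    rw [degree_mul]
    calc _ ≤ 0 + (derivative a * b - a * derivative b).degree := by
          gcongr; exact degree_C_le
      _ = _ := zero_add _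
  rw [h, h1] at h4
  exact lt_irrefl _ h4

lemma jOS (h : JData D F x A B Cp y) {Ck : Subfield E} (hC : ∀ c, c ∈ Ck ↔ D c = 0)
    (hgen : ∀ w : E, w ∈ (F ⊔ Subfield.closure (Set.range x)) ⊔ Subfield.closure (Set.range y))
    (hFK : F ≤ K) (hK : JStable D K) (a : ι)
    (ht : Transcendental K (x a)) {γ : ι → F} {k : ι → K}
    (hxk : ∀ i, x i = k i + γ i * x a) (c : κ → F) (hc : ∀ j, D (c j : E) = 0)
    (hz : ∑ j, (c j : E) * y j ∈ K ⊔ Subfield.closure {x a}) :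
    ∃ d, D d = 0 ∧ ∑ j, (c j : E) * y j - d * x a ∈ K := by
  have hd0 : ∀ i, c i ≠ 0 → jpd γ (Cp i) = 0 := by
    intro i hi
    apply jphi_inj (γ := γ) (k := k) hFK hxk h.hind
    rw [← jphi_derivative, derivative_of_natDegree_zero (jOSa h hFK hK a ht hxk c hc hz i hi),
      map_zero]
  have hC0 : ∀ j, Cp j ≠ 0 := fun j => (h.hirr j).ne_zero
  have hN : ∀ b, D b = 0 → b ∈ K := fun b hb => hFK (h.hN b hb)
  have htK : D (x a) ∈ K := hFK (h.hx a)
  have hCe : ∀ j, MvPolynomial.aeval x (Cp j) ≠ 0 := fun j => jae0 h.hind (hC0 j)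
  have hBe : ∀ j, MvPolynomial.aeval x (B j) ≠ 0 := fun j => jae0 h.hind (h.hB0 j)
  obtain ⟨w, hw⟩ : ∃ w, JRel K (x a) (∑ j, (c j : E) * y j) w := by
    obtain ⟨p, q, hq, -, hzpq⟩ := jmem_simple hz
    exact ⟨_, p, q, hq, hzpq, rfl⟩
  set n : κ → MvPolynomial ι F := fun j => jpd γ (A j) * B j - A j * jpd γ (B j) with hn
  have hDw : D w = ∑ j, (c j : E) * (MvPolynomial.aeval x (n j) /
      MvPolynomial.aeval x (Cp j * B j ^ 2)) := by
    refine jrel_unique ht (jrel_D hK htK hw) ?_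
    rw [map_sum]
    refine jrel_sum _ _ _ fun j _ => ?_
    rw [D.leibniz, hc, smul_zero, add_zero, smul_eq_mul]
    by_cases hj : c j = 0
    · rw [hj]
      simp only [ZeroMemClass.coe_zero, zero_mul]
      exact ⟨0, 1, by simp, by simp, by simp⟩
    refine jrel_const_mul _ (hFK (c j).2) ⟨jphi hFK γ k (A j), jphi hFK γ k (Cp j * B j), ?_, ?_, ?_⟩
    · rw [jphi_aeval hFK hxk, map_mul]
      exact mul_ne_zero (hCe j) (hBe j)
    · rw [jphi_aeval hFK hxk, jphi_aeval hFK hxk, h.hy, map_mul]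
    · rw [jphi_derivative, jphi_derivative]
      simp only [jphi_aeval hFK hxk, Derivation.leibniz, hd0 j hj, smul_eq_mul, map_mul,
        mul_zero, add_zero, hn, map_sub, map_pow]
      have := hCe j
      have := hBe j
      field_simp
  set Fx := F ⊔ Subfield.closure (Set.range x) with hFx
  have hFFx : F ≤ Fx := le_sup_left
  have hFxS : JStable D Fx := jstable_sup h.hF (by rintro _ ⟨i, rfl⟩; exact hFFx (h.hx i))
  have hDwx : D w ∈ Fx := by
    rw [hDw]
    exact sum_mem fun j _ => mul_mem (hFFx (c j).2) (div_mem (jaeval_memF _) (jaeval_memF _))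
  obtain ⟨v, hv, hr⟩ := jKO hC y Finset.univ Fx hFxS (fun b hb => hFFx (h.hN b hb))
    (fun i => by rw [h.hy]; exact div_mem (jaeval_memF _) (mul_mem (jaeval_memF _) (jaeval_memF _)))
    w (by simpa using hgen w) hDwx
  rw [Finset.coe_univ, Set.image_univ, Submodule.mem_span_range_iff_exists_fun] at hv
  obtain ⟨e, rfl⟩ := hv
  have he0 : ∀ j, D (e j : E) = 0 := fun j => (hC _).1 (e j).2
  let eF : κ → F := fun j => ⟨e j, h.hN _ (he0 j)⟩
  obtain ⟨ra, rb, hrb, hrab⟩ := jfrac hr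
  set N : κ → MvPolynomial ι F := fun j =>
    MvPolynomial.C (c j) * n j - MvPolynomial.C (eF j) * (A j * B j) with hNdef
  have hDr : D (w - ∑ j, e j • y j) = ∑ j, (MvPolynomial.aeval x).toRingHom (N j) /
      (MvPolynomial.aeval x).toRingHom (Cp j * B j ^ 2) := by
    rw [map_sub, hDw, map_sum, ← Finset.sum_sub_distrib]
    refine Finset.sum_congr rfl fun j _ => ?_
    change _ - D ((e j : E) * y j) = MvPolynomial.aeval x (N j) / MvPolynomial.aeval x _
    rw [D.leibniz, he0, smul_zero, add_zero, smul_eq_mul, h.hy]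
    simp only [hNdef, map_sub, map_mul, map_pow, MvPolynomial.aeval_C]
    change _ = ((c j : E) * _ - (e j : E) * _) / _
    have := hCe j
    have := hBe j
    field_simp
  have hN0 : ∀ i, N i = 0 := by
    intro i
    obtain ⟨cc, hc1, hc2, hc3⟩ := h.hC2 i
    refine jdvd_zero (c := cc) h.hF h.hx h.hind hc1 ?_ ?_
    · simp only [hNdef, hn, map_sub, Derivation.leibniz, jpd_comm, hc2, hc3, smul_eq_mul,
        map_zero, MvPolynomial.pderiv_C]
      ring
    · obtain ⟨T, hT⟩ := jpf (MvPolynomial.aeval x : MvPolynomial ι F →ₐ[F] E).toRingHom N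
        (fun j => Cp j * B j ^ 2)
        (fun j => jae0 h.hind (mul_ne_zero (hC0 j) (pow_ne_zero _ (h.hB0 j)))) i
      rw [← hDr] at hT
      have hPp := (h.hirr i).prime
      have hdv := jPL (D := D) (MvPolynomial.aeval x : MvPolynomial ι F →ₐ[F] E).toRingHom
        (fun f g hfg => jaeval_inj h.hind hfg) (fun r => jmvD h.hF h.hx r) hPp
        (fun n hn => by
          by_contra h0
          apply hPp.not_isUnit
          refine isUnit_of_dvd_unit hn ?_
          rw [← map_natCast (MvPolynomial.C : F →+* MvPolynomial ι F)]
          exact (IsUnit.mk0 _ (by exact_mod_cast h0)).map MvPolynomial.C)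
        (fun s hs => jCD h.hF h.hN h.hx h.hind hc1 hs)
        (a := ra) (b := rb)
        (v := B i ^ 2 * ∏ j ∈ Finset.univ.erase i, (Cp j * B j ^ 2))
        (u := N i * (∏ j ∈ Finset.univ.erase i, (Cp j * B j ^ 2)) + Cp i * B i ^ 2 * T)
        (by rintro rfl; simp at hrb)
        (fun hd => by
          rcases hPp.dvd_or_dvd hd with hd | hd
          · exact h.hCB i i (hPp.dvd_of_dvd_pow hd)
          · exact h.hprod i 2 hd)
        (by
          have e1 : (MvPolynomial.aeval x : MvPolynomial ι F →ₐ[F] E).toRingHom ra /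
            (MvPolynomial.aeval x : MvPolynomial ι F →ₐ[F] E).toRingHom rb =
              w - ∑ j, e j • y j := hrab.symm
          rw [← hT, e1]
          simp only [map_mul]
          ring)
      have h2 := (dvd_add_left ((dvd_mul_right (Cp i) (B i ^ 2)).mul_right T)).1 hdv
      exact (hPp.dvd_or_dvd h2).resolve_right (h.hprod i 2)
  have hcn : ∀ i, (c i : E) * (MvPolynomial.aeval x (n i) /
      MvPolynomial.aeval x (Cp i * B i ^ 2)) = 0 := by
    intro i
    have h1 : MvPolynomial.C (c i) * n i = MvPolynomial.C (eF i) * (A i * B i) :=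
      sub_eq_zero.1 (hN0 i)
    have h2 := congrArg (jphi hFK γ k) h1
    have hCphi : ∀ f, jphi hFK γ k (MvPolynomial.C f) = C (Subfield.inclusion hFK f) := by
      intro f; simp [jphi]
    simp only [hn, map_mul, map_sub, hCphi, ← jphi_derivative] at h2
    have h3 := jdeg (jphi_ne_zero hFK hxk h.hind (h.hA0 i))
      (jphi_ne_zero hFK hxk h.hind (h.hB0 i)) h2
    have h4 : eF i = 0 := Subtype.ext (by
      have := congrArg Subtype.val h3
      exact this)
    rw [h4, map_zero, zero_mul] at h1
    have h5 := congrArg (MvPolynomial.aeval x) h1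
    rw [map_mul, MvPolynomial.aeval_C, map_zero] at h5
    change (c i : E) * _ = 0 at h5
    rw [← mul_div_assoc, h5, zero_div]
  have hDw0 : D w = 0 := by rw [hDw]; exact Finset.sum_eq_zero fun i _ => hcn i
  refine ⟨w, hDw0, jrel_zero ht ?_ ?_⟩
  · exact sub_mem hz (mul_mem ((le_sup_left : K ≤ _) (hN w hDw0))
      ((le_sup_right : Subfield.closure _ ≤ _) (Subfield.subset_closure rfl)))
  · have e1 : JRel K (x a) (x a) 1 := by
      have := jrel_poly (K := K) (t := x a) X
      simpa using this
    have e2 := jrel_add hw (jrel_const_mul (-w) (neg_mem (hN w hDw0)) e1)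
    convert e2 using 1 <;> ring


lemma jKey [Fintype ι] (h : JData D F x A B Cp y) {Ck : Subfield E} (hC : ∀ c, c ∈ Ck ↔ D c = 0)
    (hgen : ∀ w : E, w ∈ (F ⊔ Subfield.closure (Set.range x)) ⊔ Subfield.closure (Set.range y))
    (hFK : F ≤ K) (hK : JStable D K) (c : κ → F) (hc : ∀ j, D (c j : E) = 0)
    (hz : ∑ j, (c j : E) * y j ∈ K ⊔ Subfield.closure (Set.range x)) :
    ∃ v ∈ Submodule.span Ck (Set.range x), ∑ j, (c j : E) * y j - v ∈ K := by
  set z := ∑ j, (c j : E) * y j with hzdef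
  have hN : ∀ b, D b = 0 → b ∈ K := fun b hb => hFK (h.hN b hb)
  obtain ⟨J, hJ, hmin⟩ := (measure (Finset.card (α := ι))).wf.has_min
    {J : Finset ι | K ⊔ Subfield.closure (x '' ↑J) = K ⊔ Subfield.closure (Set.range x)}
    ⟨Finset.univ, by simp⟩
  simp only [Set.mem_ofPred_eq] at hJ
  have hSt : ∀ s : Finset ι, JStable D (K ⊔ Subfield.closure (x '' ↑s)) := fun s =>
    jstable_sup hK (by rintro _ ⟨i, -, rfl⟩; exact (le_sup_left : K ≤ _) (hFK (h.hx i)))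
  have hins : ∀ a ∈ J, K ⊔ Subfield.closure (x '' ↑(J.erase a)) ⊔ Subfield.closure {x a} =
      K ⊔ Subfield.closure (Set.range x) := by
    intro a ha
    rw [← hJ]
    conv_rhs => rw [← Finset.insert_erase ha]
    rw [jsup_insert, sup_right_comm]
  have htr : ∀ a ∈ J, Transcendental ↥(K ⊔ Subfield.closure (x '' ↑(J.erase a))) (x a) := by
    intro a ha hal
    have h1 := jL0 (hSt _) (fun b hb => (le_sup_left : K ≤ _) (hN b hb))
      ((le_sup_left : K ≤ _) (hFK (h.hx a))) hal
    refine hmin (J.erase a) ?_ (Finset.card_erase_lt_of_mem ha)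
    rw [Set.mem_ofPred_eq, ← hins a ha]
    refine le_antisymm le_sup_left (sup_le le_rfl ?_)
    rw [Subfield.closure_le]
    simpa using h1
  have hstep : ∀ a ∈ J, ∃ d, D d = 0 ∧ z - d * x a ∈ K ⊔ Subfield.closure (x '' ↑(J.erase a)) := by
    intro a ha
    have hxi : ∀ i, ∃ g, D g = 0 ∧ x i - g * x a ∈ K ⊔ Subfield.closure (x '' ↑(J.erase a)) := by
      intro i
      refine jL (hSt _) (fun b hb => (le_sup_left : K ≤ _) (hN b hb))
        ((le_sup_left : K ≤ _) (hFK (h.hx a))) ?_ ((le_sup_left : K ≤ _) (hFK (h.hx i)))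
      rw [hins a ha]
      exact (le_sup_right : Subfield.closure _ ≤ _) (Subfield.subset_closure ⟨i, rfl⟩)
    choose g hg hgk using hxi
    exact jOS h hC hgen (hFK.trans le_sup_left) (hSt _) a (htr a ha)
      (γ := fun i => ⟨g i, h.hN _ (hg i)⟩) (k := fun i => ⟨_, hgk i⟩)
      (fun i => by simp) c hc (by rw [hins a ha]; exact hz)
  choose! d hd hdk using hstep
  set v := ∑ j ∈ J, d j * x j with hv
  have hwa : ∀ a ∈ J, z - v ∈ K ⊔ Subfield.closure (x '' ↑(J.erase a)) := by
    intro a ha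
    rw [hv, ← Finset.add_sum_erase _ _ ha, ← sub_sub]
    refine sub_mem (hdk a ha) (sum_mem fun j hj => mul_mem ?_ ?_)
    · exact (le_sup_left : K ≤ _) (hN _ (hd j (Finset.mem_of_mem_erase hj)))
    · exact (le_sup_right : Subfield.closure _ ≤ _) (Subfield.subset_closure ⟨j, hj, rfl⟩)
  have hall : ∀ r : Finset ι, r ⊆ J → z - v ∈ K ⊔ Subfield.closure (x '' ↑(J \ r)) := by
    intro r
    induction r using Finset.induction_on with
    | empty =>
      intro _
      rw [Finset.sdiff_empty, hJ]
      refine sub_mem hz (sum_mem fun j hj => mul_mem ?_ ?_)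
      · exact (le_sup_left : K ≤ _) (hN _ (hd j hj))
      · exact (le_sup_right : Subfield.closure _ ≤ _) (Subfield.subset_closure ⟨j, rfl⟩)
    | insert a r har ih =>
      intro hr
      have ha : a ∈ J := hr (by simp)
      have h1 := ih (fun i hi => hr (by simp [hi]))
      have e : J \ r = insert a (J \ insert a r) := by
        ext i
        simp only [Finset.mem_sdiff, Finset.mem_insert]
        by_cases hi : i = a
        · subst hi; simp [ha, har]
        · simp [hi]
      rw [e, jsup_insert, sup_right_comm] at h1
      refine jM (sup_le_sup_left (Subfield.closure_mono ?_) _) (htr a ha) (hwa a ha) h1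
      apply Set.image_mono
      intro i hi
      simp at hi ⊢
      tauto
  refine ⟨v, sum_mem fun j hj => ?_, ?_⟩
  · exact Submodule.smul_mem _ (⟨d j, (hC _).2 (hd j hj)⟩ : Ck) (Submodule.subset_span ⟨j, rfl⟩)
  · simpa using hall J subset_rfl

lemma jFinal [Fintype ι] (h : JData D F x A B Cp y) {Ck : Subfield E}
    (hC : ∀ c, c ∈ Ck ↔ D c = 0)
    (hgen : ∀ w : E, w ∈ (F ⊔ Subfield.closure (Set.range x)) ⊔ Subfield.closure (Set.range y))
    (hFK : F ≤ K) (hK : JStable D K) :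
    K = F ⊔ Subfield.closure
      (↑K ∩ (Submodule.span Ck (Set.range y ∪ Set.range x) : Set E)) := by
  set W : Set E := ↑K ∩ (Submodule.span Ck (Set.range y ∪ Set.range x) : Set E) with hW
  set Fx := F ⊔ Subfield.closure (Set.range x) with hFx
  set Kx := K ⊔ Subfield.closure (Set.range x) with hKx
  set L := F ⊔ Subfield.closure W with hL
  have hWK : L ≤ K := sup_le hFK (by rw [Subfield.closure_le]; exact Set.inter_subset_left)
  refine le_antisymm ?_ hWK
  have hFFx : F ≤ Fx := le_sup_left
  have hCF : ∀ c ∈ Ck, c ∈ F := fun c hc => h.hN c ((hC c).1 hc)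
  have hKxS : JStable D Kx := jstable_sup hK
    (by rintro _ ⟨i, rfl⟩; exact (le_sup_left : K ≤ _) (hFK (h.hx i)))
  have hDy : ∀ i, D (y i) ∈ Fx := fun i => by
    rw [h.hy]; exact div_mem (jaeval_memF _) (mul_mem (jaeval_memF _) (jaeval_memF _))
  have h1 := jS1 hC y hKxS Finset.univ Fx (fun a ha => hFFx (h.hN a ha))
    (sup_le_sup_right hFK _) hDy (fun a _ => by simpa using hgen a)
  rw [Finset.coe_univ, Set.image_univ] at h1
  have hsx : Submodule.span Ck (Set.range x) ≤ Submodule.span Ck (Set.range y ∪ Set.range x) :=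
    Submodule.span_mono Set.subset_union_right
  have hsy : Submodule.span Ck (Set.range y) ≤ Submodule.span Ck (Set.range y ∪ Set.range x) :=
    Submodule.span_mono Set.subset_union_left
  have h2 : Kx ≤ L ⊔ Subfield.closure (Set.range x) := by
    refine h1.trans (sup_le (sup_le_sup_right le_sup_left _) ?_)
    rw [Subfield.closure_le]
    rintro z ⟨hzK, hzs⟩
    have hzs' := hzs
    rw [SetLike.mem_coe, Submodule.mem_span_range_iff_exists_fun] at hzs'
    obtain ⟨c, hcz⟩ := hzs'
    have hcz' : z = ∑ j, ((⟨c j, hCF _ (c j).2⟩ : F) : E) * y j := hcz.symm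
    have hzK' : z ∈ Kx := hzK
    rw [hcz'] at hzK'
    obtain ⟨v, hv, hzv⟩ := jKey h hC hgen hFK hK _ (fun j => (hC _).1 (c j).2) hzK'
    rw [← hcz'] at hzv
    have : z = (z - v) + v := by ring
    rw [SetLike.mem_coe, this]
    refine add_mem ((le_sup_left : L ≤ _) ((le_sup_right : Subfield.closure W ≤ _)
      (Subfield.subset_closure ⟨hzv, sub_mem (hsy hzs) (hsx hv)⟩))) ?_
    refine jspan_le _ (fun c hc => (le_sup_left : L ≤ _) ((le_sup_left : F ≤ _) (hCF c hc))) ?_ hv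
    rintro _ ⟨i, rfl⟩
    exact (le_sup_right : Subfield.closure _ ≤ _) (Subfield.subset_closure ⟨i, rfl⟩)
  have h3 := jS1 hC x hK Finset.univ L (fun a ha => (le_sup_left : F ≤ _) (h.hN a ha)) hWK
    (fun i => (le_sup_left : F ≤ _) (h.hx i))
    (by
      rw [Finset.coe_univ, Set.image_univ]
      exact (le_sup_left : K ≤ Kx).trans h2)
  rw [Finset.coe_univ, Set.image_univ] at h3
  refine h3.trans (sup_le le_rfl ?_)
  exact le_sup_of_le_right (Subfield.closure_mono (Set.inter_subset_inter_right _ hsx))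

end OS

end part1
end helpers

/-- Let `F` be a characteristic-zero differential field with algebraically closed
field of constants `C`, let `x₁, …, x_l` be algebraically independent antiderivatives
of `F` in a no-new-constants extension `E` of `F`, and let `y₁, …, yₘ ∈ E` be J-I-E
antiderivatives of `F(x₁,…,x_l)` (i.e. `yᵢ' = Aᵢ/(Cᵢ·Bᵢ)` with `Aᵢ, Bᵢ, Cᵢ` pairwise
relatively prime polynomials satisfying conditions C1 and C2), with
`E = F(y₁,…,yₘ,x₁,…,x_l)`.  Then every intermediate field `F ⊆ K ⊆ E` closed under
the derivation has the form `K = F(S ∪ T)` with `S` a finite set of `C`-linear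
combinations of the `yᵢ` and `xⱼ`, and `T` a finite set of `C`-linear combinations
of the `xⱼ`. -/
theorem jie_two_tower_intermediate_field_structure
    {E : Type*} [Field E] [CharZero E]
    (D : E → E) (hD : IsDerivation D)
    (F : Subfield E) (hF : ∀ a ∈ F, D a ∈ F)
    (C : Subfield E) (hC : ∀ c : E, c ∈ C ↔ (c ∈ F ∧ D c = 0))
    [IsAlgClosed C]
    (hNNC : ∀ a : E, D a = 0 → a ∈ F)
    {l : ℕ} (x : Fin l → E) (hx : ∀ i, D (x i) ∈ F)
    (hind : AlgebraicIndependent F x)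
    {m : ℕ} (A B Cp : Fin m → MvPolynomial (Fin l) F)
    (hAB : ∀ i, IsRelPrime (A i) (B i))
    (hAC : ∀ i, IsRelPrime (A i) (Cp i))
    (hBC : ∀ i, IsRelPrime (B i) (Cp i))
    (hC1irr : ∀ i, Irreducible (Cp i))
    (hC1CC : ∀ i j, i ≠ j → ¬ Cp i ∣ Cp j)
    (hC1CB : ∀ i j, ¬ Cp i ∣ B j)
    (hC2 : ∀ i, ∃ c : Fin l,
      MvPolynomial.pderiv c (Cp i) ≠ 0 ∧
      MvPolynomial.pderiv c (A i) = 0 ∧ MvPolynomial.pderiv c (B i) = 0)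
    (y : Fin m → E)
    (hy : ∀ i, D (y i) =
      MvPolynomial.aeval x (A i) /
        (MvPolynomial.aeval x (Cp i) * MvPolynomial.aeval x (B i)))
    (hgen : Subfield.closure (↑F ∪ (Set.range y ∪ Set.range x)) = ⊤)
    (K : Subfield E) (hFK : F ≤ K) (hK : ∀ a ∈ K, D a ∈ K) :
    ∃ S T : Finset E,
      (∀ a ∈ S, ∃ (c : Fin m → E) (d : Fin l → E),
        (∀ j, c j ∈ C) ∧ (∀ j, d j ∈ C) ∧ a = ∑ j, c j * y j + ∑ j, d j * x j) ∧
      (∀ a ∈ T, ∃ d : Fin l → E, (∀ j, d j ∈ C) ∧ a = ∑ j, d j * x j) ∧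
      K = Subfield.closure (↑F ∪ (↑S ∪ ↑T)) := by
  classical
  let D' : Derivation ℤ E E := Derivation.mk'
    (AddMonoidHom.mk' D hD.map_add).toIntLinearMap (fun a b => by
      change D (a * b) = a * D b + b * D a
      rw [hD.leibniz]; ring)
  have hC' : ∀ c, c ∈ C ↔ D' c = 0 := fun c =>
    ⟨fun h => ((hC c).1 h).2, fun h => (hC c).2 ⟨hNNC c h, h⟩⟩
  have hdata : JData D' F x A B Cp y :=
    { hF := hF
      hN := hNNC
      hx := hx
      hind := hind
      hAC := fun i hd => (hC1irr i).not_isUnit (hAC i hd dvd_rfl)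
      hirr := hC1irr
      hCC := hC1CC
      hCB := hC1CB
      hC2 := hC2
      hy := hy }
  have hgen' : ∀ w : E,
      w ∈ (F ⊔ Subfield.closure (Set.range x)) ⊔ Subfield.closure (Set.range y) := by
    intro w
    have hw : w ∈ Subfield.closure (↑F ∪ (Set.range y ∪ Set.range x)) := by
      rw [hgen]; trivial
    rw [Subfield.closure_union, Subfield.closure_union, Subfield.closure_eq] at hw
    rwa [sup_assoc, sup_comm (Subfield.closure (Set.range x))]
  have hfin := jFinal hdata hC' hgen' hFK hK
  set V := Submodule.span C (Set.range y ∪ Set.range x) with hV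
  have hVfin : FiniteDimensional C V :=
    FiniteDimensional.span_of_finite C ((Set.finite_range y).union (Set.finite_range x))
  have hCK : C ≤ K := fun c hc => hFK ((hC c).1 hc).1
  let KS : Submodule C E :=
    { carrier := K
      add_mem' := fun ha hb => add_mem ha hb
      zero_mem' := zero_mem K
      smul_mem' := fun c a ha => mul_mem (hCK c.2) ha }
  have hWfin : FiniteDimensional C ↥(KS ⊓ V) := Submodule.finiteDimensional_inf_right KS V
  obtain ⟨S, hS⟩ := Module.Finite.iff_fg.1 hWfin
  have hSW : ∀ a ∈ S, a ∈ KS ⊓ V := fun a ha => by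
    rw [← hS]; exact Submodule.subset_span ha
  refine ⟨S, ∅, ?_, by simp, ?_⟩
  · intro a ha
    have haV : a ∈ V := (hSW a ha).2
    rw [hV, Submodule.span_union, Submodule.mem_sup] at haV
    obtain ⟨u, hu, v, hv, rfl⟩ := haV
    rw [Submodule.mem_span_range_iff_exists_fun] at hu hv
    obtain ⟨c, rfl⟩ := hu
    obtain ⟨d, rfl⟩ := hv
    exact ⟨fun j => c j, fun j => d j, fun j => (c j).2, fun j => (d j).2, rfl⟩
  · rw [Finset.coe_empty, Set.union_empty, Subfield.closure_union, Subfield.closure_eq]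
    apply le_antisymm
    · rw [hfin]
      refine sup_le le_sup_left ?_
      rw [Subfield.closure_le]
      rintro w ⟨hwK, hwV⟩
      have hw : w ∈ Submodule.span C (S : Set E) := by rw [hS]; exact ⟨hwK, hwV⟩
      refine jspan_le _ (fun c hc => (le_sup_left : F ≤ _) ((hC c).1 hc).1) ?_ hw
      exact fun s hs => (le_sup_right : Subfield.closure _ ≤ _) (Subfield.subset_closure hs)
    · refine sup_le hFK ?_
      rw [Subfield.closure_le]
      exact fun s hs => (hSW s hs).1
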